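/- Let γ ∈ (0,1]. There exists ℓ₀ > 0 such that for every v ∈ ℝ³ with v ≠ 0, min{ℓ₁(v), ℓ₂(v)} ≥ ℓ₀, where ℓ₁(v) := ∫_{ℝ³} (1 − ((v/|v|)·(w/|w|))²) |w|^{γ+2} μ(v−w) dw and ℓ₂(v) := ∫_{ℝ³} (1 − ½ |(v/|v|) × (w/|w|)|²) |w|^{γ+2} μ(v−w) dw. Equivalently, the matrix ā(v) = (a*μ)(v) satisfies ā_{ij}(v) ξ_i ξ_j ≥ ℓ₀ |ξ|² for all v ≠ 0 and ξ ∈ ℝ³. -/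

import Mathlib

open MeasureTheory Real Filter

noncomputable section

abbrev E3 : Type := EuclideanSpace ℝ (Fin 3)

/-- The standard Gaussian on ℝ³. -/
def gauss (v : E3) : ℝ :=
  (2 * π) ^ (-(3 : ℝ) / 2) * Real.exp (-‖v‖ ^ 2 / 2)

/-- `J_α(v) = ∫ |v - w|^α μ(w) dw`. -/
def Jfun (α : ℝ) (v : E3) : ℝ :=
  ∫ w : E3, ‖v - w‖ ^ α * gauss w

/-- The matrix `a_{ij}(z) = |z|^{γ+2} (δ_{ij} - z_i z_j / |z|²)` (equal to `0` at `z = 0`). -/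
def amat (γ : ℝ) (z : E3) (i j : Fin 3) : ℝ :=
  ‖z‖ ^ (γ + 2) * ((if i = j then (1 : ℝ) else 0) - z i * z j / ‖z‖ ^ 2)

/-- The entrywise convolution `ā = a * μ`. -/
def abar (γ : ℝ) (v : E3) (i j : Fin 3) : ℝ :=
  ∫ w : E3, amat γ (v - w) i j * gauss w

/-- The eigenvalue `ℓ₁(v)` of `ā(v)` in the direction `v`. -/
def ell1 (γ : ℝ) (v : E3) : ℝ :=
  ∫ w : E3, (1 - (∑ i, (v i / ‖v‖) * (w i / ‖w‖)) ^ 2) * ‖w‖ ^ (γ + 2) * gauss (v - w)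

/-- Squared norm of the cross product of two vectors of ℝ³. -/
def crossSq (u w : Fin 3 → ℝ) : ℝ :=
  (u 1 * w 2 - u 2 * w 1) ^ 2 + (u 2 * w 0 - u 0 * w 2) ^ 2 + (u 0 * w 1 - u 1 * w 0) ^ 2

/-- The eigenvalue `ℓ₂(v)` of `ā(v)` on `v^⊥`. -/
def ell2 (γ : ℝ) (v : E3) : ℝ :=
  ∫ w : E3, (1 - (1 / 2) * crossSq (fun i => v i / ‖v‖) (fun i => w i / ‖w‖)) *
    ‖w‖ ^ (γ + 2) * gauss (v - w)

def Qf (γ : ℝ) (z ξ : E3) : ℝ := ‖z‖ ^ (γ + 2) * (‖ξ‖ ^ 2 - (inner ℝ z ξ) ^ 2 / ‖z‖ ^ 2)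

def tf (z ξ : E3) : ℝ := ‖z‖ ^ 2 - (inner ℝ z ξ) ^ 2

lemma tf_nonneg (z ξ : E3) (h : ‖ξ‖ = 1) : 0 ≤ tf z ξ := by
  have := abs_real_inner_le_norm z ξ
  rw [h, mul_one] at this
  have := sq_le_sq' (by linarith [neg_abs_le (inner ℝ z ξ)]) ((le_abs_self _).trans this)
  unfold tf; linarith

lemma sum_amat (γ : ℝ) (z ξ : E3) :
    ∑ i, ∑ j, amat γ z i j * ξ i * ξ j = Qf γ z ξ := by
  unfold amat Qf
  rw [EuclideanSpace.norm_sq_eq ξ]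
  simp [Fin.sum_univ_three, PiLp.inner_apply]
  ring

lemma Qf_ge (γ : ℝ) (hγ : 0 < γ) (z ξ : E3) (h : ‖ξ‖ = 1) :
    (tf z ξ) ^ (1 + γ / 2) ≤ Qf γ z ξ := by
  have ht := tf_nonneg z ξ h
  have ht2 : tf z ξ ≤ ‖z‖ ^ 2 := by unfold tf; nlinarith [sq_nonneg (inner ℝ z ξ)]
  by_cases hz : z = 0
  · subst hz
    have : (0:ℝ) ^ (γ + 2) = 0 := Real.zero_rpow (by linarith)
    have h2 : (0:ℝ) ^ (1 + γ / 2) = 0 := Real.zero_rpow (by linarith)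
    simp [tf, Qf, this, h2]
  · have hz' : 0 < ‖z‖ := norm_pos_iff.mpr hz
    have e : Qf γ z ξ = tf z ξ * ‖z‖ ^ γ := by
      unfold Qf tf
      rw [h, Real.rpow_add hz', Real.rpow_two]
      field_simp
    rw [e, Real.rpow_add_of_nonneg ht (by norm_num) (by linarith), Real.rpow_one]
    apply mul_le_mul_of_nonneg_left _ ht
    calc (tf z ξ) ^ (γ / 2) ≤ (‖z‖ ^ 2) ^ (γ / 2) :=
          Real.rpow_le_rpow ht ht2 (by linarith)
      _ = ‖z‖ ^ γ := by
          rw [← Real.rpow_natCast, ← Real.rpow_mul hz'.le]; congr 1; push_cast; ring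

lemma gauss_nonneg (w : E3) : 0 ≤ gauss w := by unfold gauss; positivity

lemma gauss_pos (w : E3) : 0 < gauss w := by unfold gauss; positivity

lemma gauss_neg (w : E3) : gauss (-w) = gauss w := by simp [gauss]

lemma gauss_cont : Continuous gauss := by unfold gauss; fun_prop

lemma int_exp : Integrable (fun w : E3 => Real.exp (-(1/4) * ‖w‖ ^ 2)) := by
  have := GaussianFourier.integrable_cexp_neg_mul_sq_norm_add (V := E3) (b := 1/4) (by norm_num) 0 0
  have := this.norm
  refine this.congr (ae_of_all _ fun w => ?_)
  simp [Complex.norm_exp, ← Complex.ofReal_pow]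
  

lemma rpow_bound (γ : ℝ) (hγ0 : 0 < γ) (hγ1 : γ ≤ 1) (v w : E3) :
    ‖v - w‖ ^ (γ + 2) * gauss w ≤
      ((2 * π) ^ (-(3 : ℝ) / 2) * Real.exp (3 * ‖v‖ + 9)) * Real.exp (-(1/4) * ‖w‖ ^ 2) := by
  have h1 : ‖v - w‖ ^ (γ + 2) ≤ Real.exp (3 * (‖v‖ + ‖w‖)) := by
    have hx : ‖v - w‖ ≤ Real.exp (‖v‖ + ‖w‖) := by
      have := Real.add_one_le_exp (‖v‖ + ‖w‖)
      linarith [norm_sub_le v w]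
    calc ‖v - w‖ ^ (γ + 2) ≤ (Real.exp (‖v‖ + ‖w‖)) ^ (γ + 2) :=
          Real.rpow_le_rpow (norm_nonneg _) hx (by linarith)
      _ = Real.exp ((‖v‖ + ‖w‖) * (γ + 2)) := by rw [Real.exp_mul]
      _ ≤ _ := by
        apply Real.exp_le_exp.mpr
        nlinarith [norm_nonneg v, norm_nonneg w]
  calc _ ≤ Real.exp (3 * (‖v‖ + ‖w‖)) * gauss w :=
        mul_le_mul_of_nonneg_right h1 (gauss_nonneg w)
    _ = (2 * π) ^ (-(3 : ℝ) / 2) * Real.exp (3 * (‖v‖ + ‖w‖) + -‖w‖ ^ 2 / 2) := by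
        unfold gauss; rw [Real.exp_add]; ring
    _ ≤ (2 * π) ^ (-(3 : ℝ) / 2) * Real.exp ((3 * ‖v‖ + 9) + -(1/4) * ‖w‖ ^ 2) := by
        apply mul_le_mul_of_nonneg_left _ (by positivity)
        apply Real.exp_le_exp.mpr
        nlinarith [sq_nonneg (‖w‖ - 6)]
    _ = _ := by rw [Real.exp_add]; ring

/-- Domination principle. -/
lemma int_dom (γ : ℝ) (hγ0 : 0 < γ) (hγ1 : γ ≤ 1) (v : E3) (f : E3 → ℝ) (hf : Measurable f)
    (C : ℝ) (hC : ∀ w, |f w| ≤ C * ‖v - w‖ ^ (γ + 2)) :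
    Integrable (fun w => f w * gauss w) := by
  have hC0 : Integrable (fun w : E3 => |C| * (((2 * π) ^ (-(3 : ℝ) / 2) * Real.exp (3 * ‖v‖ + 9)) *
    Real.exp (-(1/4) * ‖w‖ ^ 2))) := (int_exp.const_mul _).const_mul _
  refine hC0.mono' (hf.mul gauss_cont.measurable).aestronglyMeasurable (ae_of_all _ fun w => ?_)
  rw [Real.norm_eq_abs, abs_mul, abs_of_nonneg (gauss_nonneg w)]
  calc |f w| * gauss w ≤ (|C| * ‖v - w‖ ^ (γ + 2)) * gauss w := by
        apply mul_le_mul_of_nonneg_right _ (gauss_nonneg w)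
        exact (hC w).trans (mul_le_mul_of_nonneg_right (le_abs_self C) (by positivity))
    _ = |C| * (‖v - w‖ ^ (γ + 2) * gauss w) := by ring
    _ ≤ _ := mul_le_mul_of_nonneg_left (rpow_bound γ hγ0 hγ1 v w) (abs_nonneg C)

lemma amat_meas (γ : ℝ) (i j : Fin 3) : Measurable (fun z : E3 => amat γ z i j) := by
  unfold amat; fun_prop

lemma amat_bound (γ : ℝ) (z : E3) (i j : Fin 3) : |amat γ z i j| ≤ 2 * ‖z‖ ^ (γ + 2) := by
  unfold amat
  rw [abs_mul, abs_of_nonneg (by positivity : 0 ≤ ‖z‖ ^ (γ + 2)), mul_comm]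
  apply mul_le_mul_of_nonneg_right _ (by positivity)
  have h1 : |z i * z j / ‖z‖ ^ 2| ≤ 1 := by
    rw [abs_div, abs_mul, abs_of_nonneg (by positivity : 0 ≤ ‖z‖ ^ 2)]
    apply div_le_one_of_le₀ _ (by positivity)
    have hi := PiLp.norm_apply_le z i
    have hj := PiLp.norm_apply_le z j
    rw [Real.norm_eq_abs] at hi hj
    rw [pow_two]
    exact mul_le_mul hi hj (abs_nonneg _) (norm_nonneg _)
  have h2 : |(if i = j then (1 : ℝ) else 0)| ≤ 1 := by split_ifs <;> simp
  exact (abs_sub _ _).trans (by linarith)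

lemma amat_int (γ : ℝ) (hγ0 : 0 < γ) (hγ1 : γ ≤ 1) (v : E3) (i j : Fin 3) :
    Integrable (fun w => amat γ (v - w) i j * gauss w) :=
  int_dom γ hγ0 hγ1 v _ ((amat_meas γ i j).comp (measurable_const.sub measurable_id)) 2
    (fun w => amat_bound γ (v - w) i j)

lemma Qf_int_eq (γ : ℝ) (v ξ w : E3) : Qf γ (v - w) ξ * gauss w =
    ∑ i, ∑ j, amat γ (v - w) i j * gauss w * ξ i * ξ j := by
  rw [← sum_amat, Finset.sum_mul]
  refine Finset.sum_congr rfl fun i _ => ?_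
  rw [Finset.sum_mul]
  exact Finset.sum_congr rfl fun j _ => by ring

lemma Qf_int (γ : ℝ) (hγ0 : 0 < γ) (hγ1 : γ ≤ 1) (v ξ : E3) :
    Integrable (fun w => Qf γ (v - w) ξ * gauss w) := by
  simp_rw [Qf_int_eq]
  exact integrable_finsetSum _ fun i _ => integrable_finsetSum _ fun j _ =>
    ((amat_int γ hγ0 hγ1 v i j).mul_const _).mul_const _

lemma sum_abar (γ : ℝ) (hγ0 : 0 < γ) (hγ1 : γ ≤ 1) (v ξ : E3) :
    ∑ i, ∑ j, abar γ v i j * ξ i * ξ j = ∫ w, Qf γ (v - w) ξ * gauss w := by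
  simp_rw [Qf_int_eq]
  rw [integral_finsetSum _ fun i _ => integrable_finsetSum _ fun j _ =>
    ((amat_int γ hγ0 hγ1 v i j).mul_const _).mul_const _]
  refine Finset.sum_congr rfl fun i _ => ?_
  rw [integral_finsetSum _ fun j _ =>
    ((amat_int γ hγ0 hγ1 v i j).mul_const _).mul_const _]
  refine Finset.sum_congr rfl fun j _ => ?_
  rw [integral_mul_const, integral_mul_const]; rfl

def Ff (γ : ℝ) (ξ : E3) : ℝ := ∫ w, (tf w ξ) ^ (1 + γ / 2) * gauss w

lemma tf_cont (ξ : E3) : Continuous (fun w => tf w ξ) := by unfold tf; fun_prop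

lemma tfp_cont (γ : ℝ) (hγ0 : 0 < γ) (ξ : E3) :
    Continuous (fun w => (tf w ξ) ^ (1 + γ / 2)) :=
  (tf_cont ξ).rpow_const fun _ => Or.inr (by linarith)

lemma Ff_int (γ : ℝ) (hγ0 : 0 < γ) (hγ1 : γ ≤ 1) (ξ : E3) (h : ‖ξ‖ = 1) :
    Integrable (fun w => (tf w ξ) ^ (1 + γ / 2) * gauss w) := by
  refine int_dom γ hγ0 hγ1 0 _ (tfp_cont γ hγ0 ξ).measurable 1 fun w => ?_
  have ht := tf_nonneg w ξ h
  have ht2 : tf w ξ ≤ ‖w‖ ^ 2 := by unfold tf; nlinarith [sq_nonneg (inner ℝ w ξ)]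
  rw [abs_of_nonneg (Real.rpow_nonneg ht _), zero_sub, norm_neg, one_mul]
  calc _ ≤ (‖w‖ ^ 2) ^ (1 + γ / 2) := Real.rpow_le_rpow ht ht2 (by linarith)
    _ = _ := by
      rw [← Real.rpow_natCast, ← Real.rpow_mul (norm_nonneg w)]; congr 1; push_cast; ring

lemma Ff_eq (γ : ℝ) (ξ η : E3) (h : ‖ξ‖ = ‖η‖) : Ff γ ξ = Ff γ η := by
  let R : E3 ≃ₗᵢ[ℝ] E3 := (Submodule.span ℝ {ξ - η})ᗮ.reflection
  have hR : R ξ = η := Submodule.reflection_sub h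
  unfold Ff
  rw [← (R.measurePreserving).integral_comp R.toHomeomorph.measurableEmbedding
    (fun w => (tf w η) ^ (1 + γ / 2) * gauss w)]
  refine integral_congr_ae (ae_of_all _ fun w => ?_)
  simp only [tf, gauss, R.norm_map]
  rw [← hR, R.inner_map_map]

lemma Ff_pos (γ : ℝ) (hγ0 : 0 < γ) (hγ1 : γ ≤ 1) : 0 < Ff γ (EuclideanSpace.single 0 1) := by
  have h1 : ‖(EuclideanSpace.single 0 1 : E3)‖ = 1 := by simp
  unfold Ff
  refine integral_pos_of_integrable_nonneg_nonzero (x := EuclideanSpace.single 1 1)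
    ((tfp_cont γ hγ0 _).mul gauss_cont) (Ff_int γ hγ0 hγ1 _ h1)
    (fun w => mul_nonneg (Real.rpow_nonneg (tf_nonneg w _ h1) _) (gauss_nonneg w)) ?_
  have : tf (EuclideanSpace.single 1 1) (EuclideanSpace.single 0 1) = 1 := by
    simp [tf, PiLp.inner_apply, Fin.sum_univ_three]
  rw [this]
  simpa using (gauss_pos _).ne'

lemma key (γ : ℝ) (hγ0 : 0 < γ) (hγ1 : γ ≤ 1) (v ξ : E3) (h : ‖ξ‖ = 1) :
    Ff γ ξ / 2 ≤ ∫ w, Qf γ (v - w) ξ * gauss w := by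
  have hp : (∫ w, Qf γ (v + w) ξ * gauss w) = ∫ w, Qf γ (v - w) ξ * gauss w := by
    rw [← integral_neg_eq_self (fun w => Qf γ (v + w) ξ * gauss w)]
    simp only [gauss_neg, sub_eq_add_neg]
  have hi := Qf_int γ hγ0 hγ1 v ξ
  have hi2 : Integrable (fun w => Qf γ (v + w) ξ * gauss w) := by
    have := hi.comp_neg
    simpa only [gauss_neg, sub_neg_eq_add] using this
  have : Ff γ ξ ≤ ∫ w, (Qf γ (v + w) ξ * gauss w + Qf γ (v - w) ξ * gauss w) := by
    refine integral_mono (Ff_int γ hγ0 hγ1 ξ h) (hi2.add hi) fun w => ?_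
    simp only
    rw [← add_mul]
    apply mul_le_mul_of_nonneg_right _ (gauss_nonneg w)
    have a1 := Qf_ge γ hγ0 (v + w) ξ h
    have a2 := Qf_ge γ hγ0 (v - w) ξ h
    have b1 := Real.rpow_nonneg (tf_nonneg (v + w) ξ h) (1 + γ / 2)
    have b2 := Real.rpow_nonneg (tf_nonneg (v - w) ξ h) (1 + γ / 2)
    have par : tf (v + w) ξ + tf (v - w) ξ = 2 * tf v ξ + 2 * tf w ξ := by
      have := parallelogram_law_with_norm ℝ v w
      unfold tf
      rw [inner_add_left, inner_sub_left]
      nlinarith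
    have hv := tf_nonneg v ξ h
    have hw := tf_nonneg w ξ h
    rcases le_total (tf w ξ) (tf (v + w) ξ) with hc | hc
    · have := Real.rpow_le_rpow hw hc (by linarith : 0 ≤ 1 + γ / 2)
      linarith
    · have := Real.rpow_le_rpow hw (by linarith : tf w ξ ≤ tf (v - w) ξ)
        (by linarith : 0 ≤ 1 + γ / 2)
      linarith
  rw [integral_add hi2 hi, hp] at this
  linarith

lemma flip_int (v : E3) (f : E3 → ℝ) :
    (∫ w, f w * gauss (v - w)) = ∫ w, f (v - w) * gauss w := by
  rw [← integral_sub_left_eq_self (fun w => f w * gauss (v - w)) volume v]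
  simp

lemma ell1_eq (γ : ℝ) (v : E3) (hv : v ≠ 0) :
    ell1 γ v = ∫ w, Qf γ (v - w) (‖v‖⁻¹ • v) * gauss w := by
  rw [← flip_int v (fun z => Qf γ z (‖v‖⁻¹ • v))]
  unfold ell1
  refine integral_congr_ae (ae_of_all _ fun w => ?_)
  have h1 : ‖‖v‖⁻¹ • v‖ = 1 := norm_smul_inv_norm hv
  simp only [Qf, h1]
  congr 1
  rw [mul_comm]
  congr 1
  simp [Fin.sum_univ_three, PiLp.inner_apply]
  ring

lemma cross_le (u w : E3) (h : ‖u‖ = 1) :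
    crossSq (fun i => u i) (fun i => w i / ‖w‖) ≤ 1 ∧
    0 ≤ crossSq (fun i => u i) (fun i => w i / ‖w‖) := by
  refine ⟨?_, by unfold crossSq; positivity⟩
  have hu : u 0 ^ 2 + u 1 ^ 2 + u 2 ^ 2 = 1 := by
    have := EuclideanSpace.norm_sq_eq u
    simp [h, Fin.sum_univ_three] at this
    linarith
  have hw : (w 0 / ‖w‖) ^ 2 + (w 1 / ‖w‖) ^ 2 + (w 2 / ‖w‖) ^ 2 ≤ 1 := by
    have := EuclideanSpace.norm_sq_eq w
    simp [Fin.sum_univ_three] at this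
    simp only [div_pow]
    rw [← add_div, ← add_div, ← this]
    exact div_self_le_one _
  have e : crossSq (fun i => u i) (fun i => w i / ‖w‖) =
      (u 0 ^ 2 + u 1 ^ 2 + u 2 ^ 2) * ((w 0 / ‖w‖) ^ 2 + (w 1 / ‖w‖) ^ 2 + (w 2 / ‖w‖) ^ 2)
      - (u 0 * (w 0 / ‖w‖) + u 1 * (w 1 / ‖w‖) + u 2 * (w 2 / ‖w‖)) ^ 2 := by
    unfold crossSq; ring
  rw [e, hu]
  nlinarith [sq_nonneg (u 0 * (w 0 / ‖w‖) + u 1 * (w 1 / ‖w‖) + u 2 * (w 2 / ‖w‖))]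

lemma Qf_le (γ : ℝ) (z ξ : E3) (h : ‖ξ‖ = 1) : Qf γ z ξ ≤ ‖z‖ ^ (γ + 2) := by
  unfold Qf
  rw [h]
  apply mul_le_of_le_one_right (by positivity)
  have : 0 ≤ (inner ℝ z ξ) ^ 2 / ‖z‖ ^ 2 := by positivity
  linarith

lemma ell2_ge (γ : ℝ) (hγ0 : 0 < γ) (hγ1 : γ ≤ 1) (v : E3) (hv : v ≠ 0) :
    ell1 γ v / 2 ≤ ell2 γ v := by
  have h1 : ‖‖v‖⁻¹ • v‖ = 1 := norm_smul_inv_norm hv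
  set u := ‖v‖⁻¹ • v with hu
  have hu' : (fun i => v i / ‖v‖) = (fun i => u i) := by
    ext i; simp [hu]; ring
  rw [ell1_eq γ v hv, ← integral_div]
  unfold ell2
  rw [hu', flip_int v (fun w => (1 - (1 / 2) * crossSq (fun i => u i) (fun i => w i / ‖w‖)) *
    ‖w‖ ^ (γ + 2))]
  refine integral_mono ((Qf_int γ hγ0 hγ1 v u).div_const 2) ?_ fun w => ?_
  · refine int_dom γ hγ0 hγ1 v _ ?_ 1 fun w => ?_
    · unfold crossSq; fun_prop
    · rw [abs_mul, abs_of_nonneg (by positivity : 0 ≤ ‖v - w‖ ^ (γ + 2))]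
      apply mul_le_mul_of_nonneg_right _ (by positivity)
      obtain ⟨c1, c2⟩ := cross_le u (v - w) h1
      rw [abs_le]; constructor <;> linarith
  · simp only
    rw [mul_div_right_comm]
    apply mul_le_mul_of_nonneg_right _ (gauss_nonneg w)
    obtain ⟨c1, c2⟩ := cross_le u (v - w) h1
    have := Qf_le γ (v - w) u h1
    have h3 : 0 ≤ ‖v - w‖ ^ (γ + 2) := by positivity
    nlinarith

theorem stmt6 (γ : ℝ) (hγ0 : 0 < γ) (hγ1 : γ ≤ 1) :
    ∃ ℓ₀ > (0 : ℝ), ∀ v : E3, v ≠ 0 →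
      ℓ₀ ≤ min (ell1 γ v) (ell2 γ v) ∧
      ∀ ξ : E3, ℓ₀ * ‖ξ‖ ^ 2 ≤ ∑ i, ∑ j, abar γ v i j * ξ i * ξ j := by
  have hF := Ff_pos γ hγ0 hγ1
  have hk : ∀ v ξ : E3, ‖ξ‖ = 1 →
      Ff γ (EuclideanSpace.single 0 1) / 2 ≤ ∫ w, Qf γ (v - w) ξ * gauss w := by
    intro v ξ h
    rw [Ff_eq γ (EuclideanSpace.single 0 1) ξ (by simp [h])]
    exact key γ hγ0 hγ1 v ξ h
  refine ⟨Ff γ (EuclideanSpace.single 0 1) / 4, by positivity, fun v hv => ⟨?_, fun ξ => ?_⟩⟩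
  · have h1 := hk v _ (norm_smul_inv_norm (𝕜 := ℝ) hv)
    have h2 := ell2_ge γ hγ0 hγ1 v hv
    have h3 := ell1_eq γ v hv
    simp only [RCLike.ofReal_real_eq_id, id_eq] at h1
    rw [← h3] at h1
    apply le_min <;> linarith
  · rw [sum_abar γ hγ0 hγ1]
    by_cases hξ : ξ = 0
    · subst hξ; simp [Qf]
    · have h1 : ‖‖ξ‖⁻¹ • ξ‖ = 1 := norm_smul_inv_norm hξ
      have h2 := hk v _ h1
      have hn : 0 < ‖ξ‖ := norm_pos_iff.mpr hξ
      have e : ∀ w, Qf γ (v - w) ξ * gauss w =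
          ‖ξ‖ ^ 2 * (Qf γ (v - w) (‖ξ‖⁻¹ • ξ) * gauss w) := by
        intro w
        unfold Qf
        rw [h1, inner_smul_right]
        field_simp
      simp_rw [e]
      rw [integral_const_mul, mul_comm]
      apply mul_le_mul_of_nonneg_left _ (by positivity)
      linarith
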